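/- In the interval decomposition associated with an ∞-cyclically monotone optimal plan γ̄ (with endpoints a_i, b_i and images c_i, d_i defined below), the open intervals (c_i, d_i), i ∈ I, are mutually disjoint; moreover, for each i, the sets M_γ̄^+ + λ_C and M_γ̄^- − λ_C have empty intersection with (c_i, d_i). -/

import Mathlib

open MeasureTheory Set Filter Topology
open scoped ENNReal NNReal

noncomputable section

/-- Topological support of a measure: points all of whose open neighborhoods have
positive measure. -/
def mSupport {α : Type*} [TopologicalSpace α] [MeasurableSpace α] (γ : Measure α) : Set α :=
  {x | ∀ U : Set α, IsOpen U → x ∈ U → 0 < γ U}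

/-- γ is a transport plan (coupling) between μ and ν. -/
def IsCoupling {α : Type*} [MeasurableSpace α] (μ ν : Measure α) (γ : Measure (α × α)) : Prop :=
  γ.fst = μ ∧ γ.snd = ν

/-- The γ-essential supremum of the distance |x - y|. -/
def costInf {α : Type*} [MeasurableSpace α] [PseudoEMetricSpace α]
    (γ : Measure (α × α)) : ℝ≥0∞ :=
  essSup (fun p => edist p.1 p.2) γ

/-- The L^∞ optimal transport cost W∞(μ, ν). -/
def Winfty {α : Type*} [MeasurableSpace α] [PseudoEMetricSpace α] (μ ν : Measure α) : ℝ≥0∞ :=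
  ⨅ (γ : Measure (α × α)) (_ : IsCoupling μ ν γ), costInf γ

/-- γ is an optimal plan for the L^∞ optimal transport problem. -/
def IsOptimalPlan {α : Type*} [MeasurableSpace α] [PseudoEMetricSpace α]
    (μ ν : Measure α) (γ : Measure (α × α)) : Prop :=
  IsCoupling μ ν γ ∧ costInf γ = Winfty μ ν

/-- μ is compactly supported. -/
def CompactlySupported {α : Type*} [TopologicalSpace α] [MeasurableSpace α]
    (μ : Measure α) : Prop :=
  ∃ K : Set α, IsCompact K ∧ μ Kᶜ = 0

/-- The admissible class U_λ of the dual problem. -/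
def DualAdm {α : Type*} [MeasurableSpace α] [PseudoMetricSpace α]
    (μ ν : Measure α) (lam : ℝ) (φ ψ : α → ℝ) : Prop :=
  Integrable φ μ ∧ Integrable ψ ν ∧
    ∀ᵐ x ∂μ, ∀ᵐ y ∂ν, dist x y ≤ lam → φ x + ψ y ≤ 0

/-- ∞-cyclical monotonicity of a plan on ℝ. -/
def InfCM (γ : Measure (ℝ × ℝ)) : Prop :=
  ∀ (n : ℕ) (p : Fin (n + 1) → ℝ × ℝ), (∀ i, p i ∈ mSupport γ) →
    (⨆ i, |(p i).1 - (p i).2|) ≤ ⨆ i, |(p i).1 - (p (i + 1)).2|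

/-- Points moved at maximal distance to the right. -/
def Mplus (γ : Measure (ℝ × ℝ)) (lam : ℝ) : Set ℝ := {x | (x, x + lam) ∈ mSupport γ}

/-- Points moved at maximal distance to the left. -/
def Mminus (γ : Measure (ℝ × ℝ)) (lam : ℝ) : Set ℝ := {x | (x, x - lam) ∈ mSupport γ}


/-- (ai, bi) is a maximal open subinterval (a "gap") of (a, b) \ M. -/
def IsGap (a b : ℝ) (M : Set ℝ) (ai bi : ℝ) : Prop :=
  ai < bi ∧ Set.Ioo ai bi ⊆ Set.Ioo a b \ M ∧
    ∀ a' b' : ℝ, a' < b' → Set.Ioo a' b' ⊆ Set.Ioo a b \ M →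
      Set.Ioo ai bi ⊆ Set.Ioo a' b' → a' = ai ∧ b' = bi

open scoped Classical in
/-- The left image c_i associated with a gap endpoint a_i: c if a_i = a,
a_i + λ_C if a_i ∈ M⁺, and a_i − λ_C otherwise (i.e. if a_i ∈ M⁻ \ M⁺). -/
noncomputable def cIdx (a c lam : ℝ) (Mp : Set ℝ) (ai : ℝ) : ℝ :=
  if ai = a then c else if ai ∈ Mp then ai + lam else ai - lam

open scoped Classical in
/-- The right image d_i associated with a gap endpoint b_i: d if b_i = b,
b_i − λ_C if b_i ∈ M⁻, and b_i + λ_C otherwise (i.e. if b_i ∈ M⁺ \ M⁻). -/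
noncomputable def dIdx (b d lam : ℝ) (Mm : Set ℝ) (bi : ℝ) : ℝ :=
  if bi = b then d else if bi ∈ Mm then bi - lam else bi + lam

theorem isClosed_mSupport {α : Type*} [TopologicalSpace α] [MeasurableSpace α]
    (γ : Measure α) : IsClosed (mSupport γ) := by
  rw [← isOpen_compl_iff, isOpen_iff_forall_mem_open]
  intro x hx
  simp only [mSupport, mem_compl_iff, mem_ofPred_eq, not_forall] at hx
  obtain ⟨U, hU, hxU, h⟩ := hx
  exact ⟨U, fun y hy hy' => h (hy' U hU hy), hU, hxU⟩

theorem measure_eq_zero_of_disjoint_mSupport {α : Type*} [TopologicalSpace α]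
    [SecondCountableTopology α] [MeasurableSpace α] {γ : Measure α} {U : Set α}
    (h : Disjoint U (mSupport γ)) : γ U = 0 := by
  refine measure_null_of_locally_null U fun x hx => ?_
  have hx' := Set.disjoint_left.1 h hx
  simp only [mSupport, mem_ofPred_eq, not_forall] at hx'
  obtain ⟨V, hV, hxV, h0⟩ := hx'
  exact ⟨V, mem_nhdsWithin_of_mem_nhds (hV.mem_nhds hxV), by simpa using h0⟩

theorem mSupport_subset_of_ae {α : Type*} [TopologicalSpace α] [MeasurableSpace α]
    {γ : Measure α} {F : Set α} (hF : IsClosed F) (h : ∀ᵐ x ∂γ, x ∈ F) : mSupport γ ⊆ F := by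
  intro x hx
  by_contra hxF
  exact (hx _ hF.isOpen_compl hxF).ne' h

theorem IsCoupling.fst_mem_mSupport {α : Type*} [TopologicalSpace α] [MeasurableSpace α]
    [OpensMeasurableSpace α] {μ ν : Measure α} {γ : Measure (α × α)} (h : IsCoupling μ ν γ)
    {p : α × α} (hp : p ∈ mSupport γ) : p.1 ∈ mSupport μ := by
  intro U hU hpU
  rw [← h.1, Measure.fst_apply hU.measurableSet]
  exact hp _ (hU.preimage continuous_fst) hpU

theorem IsCoupling.costInf_ne_top {α : Type*} [PseudoMetricSpace α] [MeasurableSpace α]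
    {μ ν : Measure α} {γ : Measure (α × α)} (h : IsCoupling μ ν γ)
    (hμ : CompactlySupported μ) (hν : CompactlySupported ν) : costInf γ ≠ ⊤ := by
  obtain ⟨K, hK, hK0⟩ := hμ
  obtain ⟨L, hL, hL0⟩ := hν
  have h1 : ∀ᵐ p ∂γ, p.1 ∈ K :=
    ae_of_ae_map measurable_fst.aemeasurable (p := fun x => x ∈ K) (by
      change ∀ᵐ x ∂γ.fst, x ∈ K
      rw [h.1]; exact hK0)
  have h2 : ∀ᵐ p ∂γ, p.2 ∈ L :=
    ae_of_ae_map measurable_snd.aemeasurable (p := fun x => x ∈ L) (by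
      change ∀ᵐ x ∂γ.snd, x ∈ L
      rw [h.2]; exact hL0)
  have hb : Metric.ediam (K ∪ L) ≠ ⊤ := (hK.union hL).isBounded.ediam_ne_top
  refine ne_top_of_le_ne_top hb (essSup_le_of_ae_le _ ?_)
  filter_upwards [h1, h2] with p hp1 hp2
  exact Metric.edist_le_ediam_of_mem (Or.inl hp1) (Or.inr hp2)

theorem IsOptimalPlan.abs_sub_le {μ ν : Measure ℝ} {γ : Measure (ℝ × ℝ)}
    (h : IsOptimalPlan μ ν γ) (hμ : CompactlySupported μ) (hν : CompactlySupported ν)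
    {p : ℝ × ℝ} (hp : p ∈ mSupport γ) : |p.1 - p.2| ≤ (Winfty μ ν).toReal := by
  have htop : Winfty μ ν ≠ ⊤ := h.2 ▸ h.1.costInf_ne_top hμ hν
  refine mSupport_subset_of_ae (F := {p : ℝ × ℝ | |p.1 - p.2| ≤ (Winfty μ ν).toReal})
    (isClosed_le (by fun_prop) continuous_const) ?_ hp
  filter_upwards [ae_le_essSup (f := fun p : ℝ × ℝ => edist p.1 p.2) (μ := γ)] with q hq
  change _ ≤ costInf γ at hq
  rw [h.2, edist_dist] at hq
  rw [← Real.dist_eq]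
  exact (ENNReal.ofReal_le_iff_le_toReal htop).1 hq

theorem InfCM.abs_sub_le_max {γ : Measure (ℝ × ℝ)} (h : InfCM γ) {p q : ℝ × ℝ}
    (hp : p ∈ mSupport γ) (hq : q ∈ mSupport γ) :
    |p.1 - p.2| ≤ max |p.1 - q.2| |q.1 - p.2| := by
  have := h 1 ![p, q] (by intro i; fin_cases i <;> simpa)
  refine (le_ciSup (f := fun i => |(![p, q] i).1 - (![p, q] i).2|)
    (Set.finite_range _).bddAbove 0).trans (this.trans (ciSup_le fun i => ?_))
  fin_cases i <;> simp

/-- A point moved by the maximal distance to the right splits the plan monotonically. -/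
theorem InfCM.add_le_snd {γ : Measure (ℝ × ℝ)} (h : InfCM γ) {lam : ℝ}
    (hlam : ∀ p ∈ mSupport γ, |p.1 - p.2| ≤ lam) {x : ℝ} (hx : x ∈ Mplus γ lam)
    {p : ℝ × ℝ} (hp : p ∈ mSupport γ) (hxp : x < p.1) : x + lam ≤ p.2 := by
  by_contra! hlt
  have hmax := h.abs_sub_le_max hx hp
  have hd := abs_le.1 (hlam p hp)
  have hx0 := hlam _ hx
  simp only [sub_add_cancel_left, abs_neg] at hmax hx0
  have h1 : |x - p.2| < lam := abs_lt.2 ⟨by linarith, by linarith⟩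
  have h2 : |p.1 - (x + lam)| < lam := abs_lt.2 ⟨by linarith, by linarith⟩
  exact absurd (hmax.trans_lt (max_lt h1 h2)) (le_abs_self lam).not_gt

/-- A point moved by the maximal distance to the left splits the plan monotonically. -/
theorem InfCM.snd_le_sub {γ : Measure (ℝ × ℝ)} (h : InfCM γ) {lam : ℝ}
    (hlam : ∀ p ∈ mSupport γ, |p.1 - p.2| ≤ lam) {x : ℝ} (hx : x ∈ Mminus γ lam)
    {p : ℝ × ℝ} (hp : p ∈ mSupport γ) (hxp : p.1 < x) : p.2 ≤ x - lam := by
  by_contra! hlt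
  have hmax := h.abs_sub_le_max hx hp
  have hd := abs_le.1 (hlam p hp)
  simp only [sub_sub_cancel] at hmax
  have h1 : |x - p.2| < lam := abs_lt.2 ⟨by linarith, by linarith⟩
  have h2 : |p.1 - (x - lam)| < lam := abs_lt.2 ⟨by linarith, by linarith⟩
  exact absurd (hmax.trans_lt (max_lt h1 h2)) (le_abs_self lam).not_gt

/-- If the plan sends almost every point into a closed set, the support of the second marginal
lies in that set. -/
theorem IsCoupling.mSupport_snd_subset {μ ν : Measure ℝ} {γ : Measure (ℝ × ℝ)}
    (h : IsCoupling μ ν γ) {F : Set ℝ} (hF : IsClosed F) {N : Set ℝ} (hN : μ N = 0)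
    (hNF : ∀ p ∈ mSupport γ, p.1 ∉ N → p.2 ∈ F) : mSupport ν ⊆ F := by
  refine mSupport_subset_of_ae hF ?_
  rw [← h.2, Measure.snd]
  refine (ae_map_iff measurable_snd.aemeasurable hF.measurableSet).2 ?_
  have h1 : ∀ᵐ p ∂γ, p.1 ∉ N :=
    ae_of_ae_map measurable_fst.aemeasurable (p := fun x => x ∉ N) (by
      change ∀ᵐ x ∂γ.fst, x ∉ N
      rw [h.1]; exact measure_eq_zero_iff_ae_notMem.1 hN)
  have h2 : ∀ᵐ p ∂γ, p ∈ mSupport γ :=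
    measure_eq_zero_of_disjoint_mSupport disjoint_compl_left
  filter_upwards [h1, h2] with p hp1 hp2
  exact hNF p hp2 hp1

theorem IsGap.bounds {a b : ℝ} {M : Set ℝ} {s t : ℝ} (h : IsGap a b M s t) :
    a ≤ s ∧ t ≤ b :=
  (Ioo_subset_Ioo_iff h.1).1 fun _ hx => (h.2.1 hx).1

theorem IsGap.left_mem {a b : ℝ} {M : Set ℝ} (hM : IsClosed M) {s t : ℝ}
    (h : IsGap a b M s t) (hs : s ≠ a) : s ∈ M := by
  by_contra hsM
  have has : a < s := lt_of_le_of_ne h.bounds.1 hs.symm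
  obtain ⟨l, hl, hlM⟩ := exists_Ioc_subset_of_mem_nhds
    (inter_mem (hM.isOpen_compl.mem_nhds hsM) (lt_mem_nhds has)) ⟨a, has⟩
  refine hl.ne (h.2.2 l t (hl.trans h.1) (fun x hx => ?_) (Ioo_subset_Ioo_left hl.le)).1
  rcases le_or_gt x s with hxs | hxs
  · exact ⟨⟨(hlM ⟨hx.1, hxs⟩).2, hx.2.trans_le h.bounds.2⟩, (hlM ⟨hx.1, hxs⟩).1⟩
  · exact h.2.1 ⟨hxs, hx.2⟩

theorem IsGap.right_mem {a b : ℝ} {M : Set ℝ} (hM : IsClosed M) {s t : ℝ}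
    (h : IsGap a b M s t) (ht : t ≠ b) : t ∈ M := by
  by_contra htM
  have htb : t < b := lt_of_le_of_ne h.bounds.2 ht
  obtain ⟨u, hu, huM⟩ := exists_Ico_subset_of_mem_nhds
    (inter_mem (hM.isOpen_compl.mem_nhds htM) (gt_mem_nhds htb)) ⟨b, htb⟩
  refine hu.ne' (h.2.2 s u (h.1.trans hu) (fun x hx => ?_) (Ioo_subset_Ioo_right hu.le)).2
  rcases lt_or_ge x t with hxt | hxt
  · exact h.2.1 ⟨hx.1, hxt⟩
  · exact ⟨⟨h.bounds.1.trans_lt hx.1, (huM ⟨hxt, hx.2⟩).2⟩, (huM ⟨hxt, hx.2⟩).1⟩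

theorem IsGap.eq_of_overlap {a b : ℝ} {M : Set ℝ} {s t s' t' : ℝ}
    (h : IsGap a b M s t) (h' : IsGap a b M s' t') (h1 : s' < t) (h2 : s < t') :
    (s, t) = (s', t') := by
  have key : Ioo (min s s') (max t t') ⊆ Ioo a b \ M := by
    rw [← Ioo_union_Ioo' h1 h2]
    exact union_subset h.2.1 h'.2.1
  have hlt : min s s' < max t t' := (min_le_left _ _).trans_lt (h.1.trans_le (le_max_left _ _))
  obtain ⟨e1, e2⟩ := h.2.2 _ _ hlt key (Ioo_subset_Ioo (min_le_left _ _) (le_max_left _ _))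
  obtain ⟨e3, e4⟩ := h'.2.2 _ _ hlt key (Ioo_subset_Ioo (min_le_right _ _) (le_max_right _ _))
  rw [← e1, ← e2, e3, e4]

theorem sub_le_cIdx {a c lam : ℝ} {Mp : Set ℝ} {s : ℝ} (hlam : 0 ≤ lam) (hs : s ≠ a) :
    s - lam ≤ cIdx a c lam Mp s := by
  unfold cIdx
  rw [if_neg hs]
  split_ifs <;> linarith

theorem dIdx_le_add {b d lam : ℝ} {Mm : Set ℝ} {t : ℝ} (hlam : 0 ≤ lam) (ht : t ≠ b) :
    dIdx b d lam Mm t ≤ t + lam := by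
  unfold dIdx
  rw [if_neg ht]
  split_ifs <;> linarith

section Images

variable {γ : Measure (ℝ × ℝ)} {lam : ℝ}

theorem isClosed_Mplus_union_Mminus : IsClosed (Mplus γ lam ∪ Mminus γ lam) :=
  ((isClosed_mSupport γ).preimage (by fun_prop : Continuous fun x : ℝ => (x, x + lam))).union
    ((isClosed_mSupport γ).preimage (by fun_prop : Continuous fun x : ℝ => (x, x - lam)))

theorem InfCM.add_le_cIdx (h : InfCM γ) (hlam : ∀ p ∈ mSupport γ, |p.1 - p.2| ≤ lam)
    {a c x s : ℝ} (hx : x ∈ Mplus γ lam) (hs : s ∈ Mplus γ lam ∪ Mminus γ lam) (hsa : s ≠ a)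
    (hxs : x ≤ s) : x + lam ≤ cIdx a c lam (Mplus γ lam) s := by
  unfold cIdx
  rw [if_neg hsa]
  split_ifs with hsp
  · linarith
  · exact h.add_le_snd hlam hx (hs.resolve_left hsp)
      (lt_of_le_of_ne hxs (ne_of_mem_of_not_mem hx hsp))

theorem InfCM.dIdx_le_sub (h : InfCM γ) (hlam : ∀ p ∈ mSupport γ, |p.1 - p.2| ≤ lam)
    {b d x t : ℝ} (hx : x ∈ Mminus γ lam) (ht : t ∈ Mplus γ lam ∪ Mminus γ lam) (htb : t ≠ b)
    (htx : t ≤ x) : dIdx b d lam (Mminus γ lam) t ≤ x - lam := by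
  unfold dIdx
  rw [if_neg htb]
  split_ifs with htm
  · linarith
  · exact h.snd_le_sub hlam hx (ht.resolve_right htm)
      (lt_of_le_of_ne htx (ne_of_mem_of_not_mem hx htm).symm)

theorem InfCM.dIdx_le_cIdx (h : InfCM γ) (hlam : ∀ p ∈ mSupport γ, |p.1 - p.2| ≤ lam)
    (hlam0 : 0 ≤ lam) {a b c d s t s' t' : ℝ}
    (hg : IsGap a b (Mplus γ lam ∪ Mminus γ lam) s t)
    (hg' : IsGap a b (Mplus γ lam ∪ Mminus γ lam) s' t') (hle : t ≤ s') :
    dIdx b d lam (Mminus γ lam) t ≤ cIdx a c lam (Mplus γ lam) s' := by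
  have htb : t ≠ b := (hle.trans_lt (hg'.1.trans_le hg'.bounds.2)).ne
  have hsa : s' ≠ a := (hg.bounds.1.trans_lt (hg.1.trans_le hle)).ne'
  have ht := hg.right_mem isClosed_Mplus_union_Mminus htb
  have hs := hg'.left_mem isClosed_Mplus_union_Mminus hsa
  rcases ht with htp | htm
  · exact (dIdx_le_add hlam0 htb).trans (h.add_le_cIdx hlam htp hs hsa hle)
  · exact (h.dIdx_le_sub hlam htm (Or.inr htm) htb le_rfl).trans
      ((sub_le_sub_right hle lam).trans (sub_le_cIdx hlam0 hsa))

end Images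

/-- The images (c_i, d_i) of distinct gaps (a_i, b_i) of (a,b) \ M_γ̄ are mutually
disjoint open intervals; moreover M_γ̄⁺ + λ_C and M_γ̄⁻ − λ_C never meet (c_i, d_i). -/
theorem gap_images_disjoint
    (μ ν : Measure ℝ)
    [IsProbabilityMeasure μ] [IsProbabilityMeasure ν] [NullSingletonClass μ] [NullSingletonClass ν]
    (hμ : CompactlySupported μ) (hν : CompactlySupported ν)
    (γbar : Measure (ℝ × ℝ)) (hγbar : IsOptimalPlan μ ν γbar) (hcm : InfCM γbar)
    (lamC : ℝ) (hlamC : lamC = (Winfty μ ν).toReal)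
    (a b c d : ℝ)
    (ha : IsGLB (mSupport μ) a) (hb : IsLUB (mSupport μ) b) (hab : a < b)
    (hc : IsGLB (mSupport ν) c) (hd : IsLUB (mSupport ν) d) (hcd : c < d)
    :
    (∀ a₁ b₁ a₂ b₂ : ℝ,
      IsGap a b (Mplus γbar lamC ∪ Mminus γbar lamC) a₁ b₁ →
      IsGap a b (Mplus γbar lamC ∪ Mminus γbar lamC) a₂ b₂ →
      (a₁, b₁) ≠ (a₂, b₂) →
      Set.Ioo (cIdx a c lamC (Mplus γbar lamC) a₁) (dIdx b d lamC (Mminus γbar lamC) b₁) ∩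
        Set.Ioo (cIdx a c lamC (Mplus γbar lamC) a₂) (dIdx b d lamC (Mminus γbar lamC) b₂)
          = ∅) ∧
    (∀ ai bi : ℝ, IsGap a b (Mplus γbar lamC ∪ Mminus γbar lamC) ai bi →
      ((fun x => x + lamC) '' Mplus γbar lamC) ∩
        Set.Ioo (cIdx a c lamC (Mplus γbar lamC) ai) (dIdx b d lamC (Mminus γbar lamC) bi)
          = ∅ ∧
      ((fun x => x - lamC) '' Mminus γbar lamC) ∩
        Set.Ioo (cIdx a c lamC (Mplus γbar lamC) ai) (dIdx b d lamC (Mminus γbar lamC) bi)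
          = ∅) := by
  have hlam : ∀ p ∈ mSupport γbar, |p.1 - p.2| ≤ lamC := fun p hp =>
    hlamC ▸ hγbar.abs_sub_le hμ hν hp
  have hlam0 : 0 ≤ lamC := hlamC ▸ ENNReal.toReal_nonneg
  have hcoup := hγbar.1
  have hfst : ∀ p ∈ mSupport γbar, a ≤ p.1 ∧ p.1 ≤ b := fun p hp =>
    ⟨ha.1 (hcoup.fst_mem_mSupport hp), hb.1 (hcoup.fst_mem_mSupport hp)⟩
  have hlow : ∀ y, (∀ p ∈ mSupport γbar, p.1 ∉ ({a} : Set ℝ) → y ≤ p.2) → y ≤ c := fun y hy =>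
    hc.2 fun z hz => hcoup.mSupport_snd_subset isClosed_Ici (measure_singleton a) hy hz
  have hupp : ∀ y, (∀ p ∈ mSupport γbar, p.1 ∉ ({b} : Set ℝ) → p.2 ≤ y) → d ≤ y := fun y hy =>
    hd.2 fun z hz => hcoup.mSupport_snd_subset isClosed_Iic (measure_singleton b) hy hz
  have hcl := isClosed_Mplus_union_Mminus (γ := γbar) (lam := lamC)
  refine ⟨fun a₁ b₁ a₂ b₂ h₁ h₂ hne => ?_, fun s t hg => ⟨?_, ?_⟩⟩
  · rw [eq_empty_iff_forall_notMem]
    rintro z ⟨hz₁, hz₂⟩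
    rcases le_or_gt b₁ a₂ with h | h
    · exact absurd (hz₂.1.trans hz₁.2) (hcm.dIdx_le_cIdx hlam hlam0 h₁ h₂ h).not_gt
    rcases le_or_gt b₂ a₁ with h' | h'
    · exact absurd (hz₁.1.trans hz₂.2) (hcm.dIdx_le_cIdx hlam hlam0 h₂ h₁ h').not_gt
    · exact hne (h₁.eq_of_overlap h₂ h h')
  · rw [eq_empty_iff_forall_notMem]
    rintro _ ⟨⟨x, hx, rfl⟩, hz⟩
    rcases le_or_gt x s with hxs | hsx
    · refine absurd hz.1 (not_lt.2 ?_)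
      by_cases hsa : s = a
      · obtain rfl : x = a := le_antisymm (hxs.trans hsa.le) (hfst _ hx).1
        rw [cIdx, if_pos hsa]
        exact hlow _ fun p hp hpa =>
          hcm.add_le_snd hlam hx hp (lt_of_le_of_ne (hfst p hp).1 (Ne.symm hpa))
      · exact hcm.add_le_cIdx hlam hx (hg.left_mem hcl hsa) hsa hxs
    · have htx : t ≤ x := not_lt.1 fun hxt => (hg.2.1 ⟨hsx, hxt⟩).2 (Or.inl hx)
      refine absurd hz.2 (not_lt.2 ?_)
      by_cases htb : t = b
      · rw [dIdx, if_pos htb]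
        refine hupp _ fun p hp _ => ?_
        linarith [(abs_le.1 (hlam p hp)).1, (hfst p hp).2]
      · exact (dIdx_le_add hlam0 htb).trans (by linarith)
  · rw [eq_empty_iff_forall_notMem]
    rintro _ ⟨⟨x, hx, rfl⟩, hz⟩
    rcases lt_or_ge x t with hxt | htx
    · have hxs : x ≤ s := not_lt.1 fun hsx => (hg.2.1 ⟨hsx, hxt⟩).2 (Or.inr hx)
      refine absurd hz.1 (not_lt.2 ?_)
      by_cases hsa : s = a
      · rw [cIdx, if_pos hsa]
        refine hlow _ fun p hp _ => ?_
        linarith [(abs_le.1 (hlam p hp)).2, (hfst p hp).1]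
      · exact le_trans (by linarith) (sub_le_cIdx hlam0 hsa)
    · refine absurd hz.2 (not_lt.2 ?_)
      by_cases htb : t = b
      · obtain rfl : x = b := le_antisymm (hfst _ hx).2 (htb.ge.trans htx)
        rw [dIdx, if_pos htb]
        exact hupp _ fun p hp hpb =>
          hcm.snd_le_sub hlam hx hp (lt_of_le_of_ne (hfst p hp).2 hpb)
      · exact hcm.dIdx_le_sub hlam hx (hg.right_mem hcl htb) htb htx

end
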